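/- arXiv:1209.4687 — 2 statements merged into one kernel-verified Lean document; each statement's English description precedes it below -/
import Mathlib

section
/- Fix 0 < q < 1 and γ > 0, and define f_λ(x;μ) = d(x;μ) − I(μ) − λ(x² − γ) and g_λ(x;μ) = q·f_λ(0;μ) + (1−q)·f_λ(x;μ). A measure μ₀ ∈ Λ(γ,q) maximizes I(μ) over Λ(γ,q) if and only if there exists λ ≥ 0 such that g_λ(x;μ₀) ≤ 0 for every x ∈ ℝ. Furthermore, in that case g_λ(x;μ₀) = 0 for every point of increase x of μ₀ with x ≠ 0. -/
open MeasureTheory Real Filter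

/-- The standard Gaussian density `φ(t) = (2π)^{-1/2} e^{-t²/2}`. -/
noncomputable def gauss (t : ℝ) : ℝ := Real.exp (-t ^ 2 / 2) / Real.sqrt (2 * Real.pi)

/-- The output density `p_Y(y;μ) = ∫ φ(y−x) dμ(x)`. -/
noncomputable def outDen (μ : Measure ℝ) (y : ℝ) : ℝ := ∫ x, gauss (y - x) ∂μ

/-- The relative entropy `d(x;μ) = ∫ φ(y−x) log(φ(y−x)/p_Y(y;μ)) dy`. -/
noncomputable def relEnt (x : ℝ) (μ : Measure ℝ) : ℝ :=
  ∫ y, gauss (y - x) * Real.log (gauss (y - x) / outDen μ y)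

/-- The mutual information `I(μ) = ∫ d(x;μ) dμ(x)`. -/
noncomputable def mutInfo (μ : Measure ℝ) : ℝ := ∫ x, relEnt x μ ∂μ

/-- The constraint set `Λ(γ,q)`: probability measures with `μ({0}) ≥ q` and second moment
at most `γ`. -/
def memLam (γ q : ℝ) (μ : Measure ℝ) : Prop :=
  IsProbabilityMeasure μ ∧ ENNReal.ofReal q ≤ μ {0} ∧
    ∫⁻ x, ENNReal.ofReal (x ^ 2) ∂μ ≤ ENNReal.ofReal γ

/-- The function `f_λ(x;μ) = d(x;μ) − I(μ) − λ(x² − γ)`. -/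
noncomputable def fCost (γ lam x : ℝ) (μ : Measure ℝ) : ℝ :=
  relEnt x μ - mutInfo μ - lam * (x ^ 2 - γ)

/-- The function `g_λ(x;μ) = q·f_λ(0;μ) + (1−q)·f_λ(x;μ)`. -/
noncomputable def gCost (γ q lam x : ℝ) (μ : Measure ℝ) : ℝ :=
  q * fCost γ lam 0 μ + (1 - q) * fCost γ lam x μ

/-- The set of points of increase of `μ`. -/
def ptsIncrease (μ : Measure ℝ) : Set ℝ := {x : ℝ | ∀ O : Set ℝ, IsOpen O → x ∈ O → 0 < μ O}


namespace MIAux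

structure Good (q : ℝ) (μ : Measure ℝ) : Prop where
  prob : IsProbabilityMeasure μ
  atom : q ≤ μ.real {0}
  sq : Integrable (fun x : ℝ => x ^ 2) μ

lemma gauss_pos (t : ℝ) : 0 < gauss t := by unfold gauss; positivity

lemma gauss_cont : Continuous gauss := by unfold gauss; fun_prop

lemma gauss_le_one (t : ℝ) : gauss t ≤ 1 := by
  unfold gauss
  rw [div_le_one (by positivity)]
  have h1 : Real.exp (-t ^ 2 / 2) ≤ 1 := Real.exp_le_one_iff.2 (by nlinarith [sq_nonneg t])
  have h2 : (1 : ℝ) ≤ Real.sqrt (2 * Real.pi) := by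
    rw [Real.one_le_sqrt]; nlinarith [Real.pi_gt_three]
  linarith

lemma gauss_eq_pdf (y : ℝ) : gauss y = ProbabilityTheory.gaussianPDFReal 0 1 y := by
  simp [gauss, ProbabilityTheory.gaussianPDFReal, div_eq_inv_mul]

lemma gauss_int : Integrable gauss := by
  have : gauss = ProbabilityTheory.gaussianPDFReal 0 1 := funext gauss_eq_pdf
  rw [this]; exact ProbabilityTheory.integrable_gaussianPDFReal 0 1

lemma gauss_integral : ∫ y, gauss y = 1 := by
  have : gauss = ProbabilityTheory.gaussianPDFReal 0 1 := funext gauss_eq_pdf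
  rw [this]; exact ProbabilityTheory.integral_gaussianPDFReal_eq_one 0 one_ne_zero

lemma gauss_sq_int : Integrable (fun y => gauss y * y ^ 2) := by
  have h := integrable_rpow_mul_exp_neg_mul_sq (b := 1 / 2) (by norm_num) (s := 2) (by norm_num)
  refine (h.div_const (Real.sqrt (2 * Real.pi))).congr (ae_of_all _ fun y => ?_)
  simp only [gauss, Real.rpow_two]
  rw [show -(1 / 2 : ℝ) * y ^ 2 = -y ^ 2 / 2 by ring]
  ring

lemma log_gauss (t : ℝ) : Real.log (gauss t) = -t ^ 2 / 2 - Real.log (Real.sqrt (2 * Real.pi)) := by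
  unfold gauss
  rw [Real.log_div (Real.exp_pos _).ne' (by positivity), Real.log_exp]

/-- the integral of the dominating function -/
lemma dom_int (A B x : ℝ) :
    Integrable (fun y => gauss (y - x) * (A + B * (y - x) ^ 2)) ∧
    ∫ y, gauss (y - x) * (A + B * (y - x) ^ 2) = A + B * ∫ y, gauss y * y ^ 2 := by
  have h : Integrable (fun y => gauss y * (A + B * y ^ 2)) := by
    refine ((gauss_int.const_mul A).add (gauss_sq_int.const_mul B)).congr (ae_of_all _ fun y => ?_)
    simp only [Pi.add_apply]; ring
  refine ⟨h.comp_sub_right x, ?_⟩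
  rw [integral_sub_right_eq_self (fun y => gauss y * (A + B * y ^ 2)) x]
  have : (fun y => gauss y * (A + B * y ^ 2)) = fun y => A * gauss y + B * (gauss y * y ^ 2) := by
    ext y; ring
  rw [this, integral_add (gauss_int.const_mul A) (gauss_sq_int.const_mul B),
    integral_const_mul, integral_const_mul, gauss_integral, mul_one]

lemma gauss_sub_int (x : ℝ) : Integrable (fun y => gauss (y - x)) := gauss_int.comp_sub_right x

lemma gauss_mu_int (μ : Measure ℝ) [IsFiniteMeasure μ] (y : ℝ) :
    Integrable (fun x => gauss (y - x)) μ := by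
  refine Integrable.of_bound (C := 1) ?_ (ae_of_all _ fun x => ?_)
  · exact (gauss_cont.comp (continuous_const.sub continuous_id)).aestronglyMeasurable
  · rw [Real.norm_eq_abs, abs_of_pos (gauss_pos _)]; exact gauss_le_one _

lemma outDen_cont (μ : Measure ℝ) [IsFiniteMeasure μ] : Continuous (outDen μ) := by
  unfold outDen
  refine continuous_of_dominated (bound := fun _ => 1) ?_ ?_ (integrable_const _) ?_
  · intro y
    exact (gauss_mu_int μ y).aestronglyMeasurable
  · intro y
    exact ae_of_all _ fun x => by
      rw [Real.norm_eq_abs, abs_of_pos (gauss_pos _)]; exact gauss_le_one _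
  · exact ae_of_all _ fun x => gauss_cont.comp (continuous_id.sub continuous_const)

variable {q : ℝ} {μ ν : Measure ℝ}

lemma outDen_le (h : Good q μ) (y : ℝ) : outDen μ y ≤ 1 := by
  have := h.prob
  calc outDen μ y ≤ ∫ _, (1 : ℝ) ∂μ :=
        integral_mono (gauss_mu_int μ y) (integrable_const _) fun x => gauss_le_one _
    _ = 1 := by simp

lemma le_outDen (h : Good q μ) (y : ℝ) : q * gauss y ≤ outDen μ y := by
  have := h.prob
  calc q * gauss y ≤ μ.real {0} * gauss y := by
        have := h.atom
        have := gauss_pos y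
        gcongr
    _ = ∫ x in {0}, gauss (y - x) ∂μ := by
        rw [integral_singleton]; simp
    _ ≤ outDen μ y :=
        setIntegral_le_integral (gauss_mu_int μ y) (ae_of_all _ fun x => (gauss_pos _).le)

lemma outDen_pos (hq : 0 < q) (h : Good q μ) (y : ℝ) : 0 < outDen μ y :=
  (mul_pos hq (gauss_pos y)).trans_le (le_outDen h y)

lemma log_outDen_cont (hq : 0 < q) (h : Good q μ) :
    Continuous (fun y => Real.log (outDen μ y)) := by
  have := h.prob
  exact (outDen_cont μ).log fun y => (outDen_pos hq h y).ne'

lemma log_outDen_bound (hq : 0 < q) (h : Good q μ) :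
    ∃ A : ℝ, 0 ≤ A ∧ ∀ y, |Real.log (outDen μ y)| ≤ A + y ^ 2 / 2 := by
  refine ⟨|Real.log (Real.sqrt (2 * Real.pi)) - Real.log q|, abs_nonneg _, fun y => ?_⟩
  have h1 : Real.log (outDen μ y) ≤ 0 :=
    Real.log_nonpos (outDen_pos hq h y).le (outDen_le h y)
  have h2 := Real.log_le_log (mul_pos hq (gauss_pos y)) (le_outDen h y)
  rw [Real.log_mul hq.ne' (gauss_pos y).ne', log_gauss] at h2
  rw [abs_of_nonpos h1]
  have := le_abs_self (Real.log (Real.sqrt (2 * Real.pi)) - Real.log q)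
  linarith

lemma bound_aux {A : ℝ} (x y : ℝ) {l : ℝ} (hl : |l| ≤ A + y ^ 2 / 2) :
    ‖gauss (y - x) * l‖ ≤ gauss (y - x) * ((A + x ^ 2) + 1 * (y - x) ^ 2) := by
  rw [norm_mul, Real.norm_eq_abs, abs_of_pos (gauss_pos _), Real.norm_eq_abs]
  refine mul_le_mul_of_nonneg_left ?_ (gauss_pos _).le
  nlinarith [sq_nonneg (y - 2 * x)]

lemma inner_int (hq : 0 < q) (h : Good q μ) (x : ℝ) :
    Integrable (fun y => gauss (y - x) * Real.log (outDen μ y)) := by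
  obtain ⟨A, hA, hb⟩ := log_outDen_bound hq h
  refine (dom_int (A + x ^ 2) 1 x).1.mono' ?_ (ae_of_all _ fun y => bound_aux x y (hb y))
  exact ((gauss_cont.comp (continuous_id.sub continuous_const)).mul
    (log_outDen_cont hq h)).aestronglyMeasurable

noncomputable def KK : ℝ := ∫ y, gauss y * Real.log (gauss y)

lemma relEnt_eq (hq : 0 < q) (h : Good q μ) (x : ℝ) :
    relEnt x μ = KK - ∫ y, gauss (y - x) * Real.log (outDen μ y) := by
  have h1 : Integrable (fun y => gauss y * Real.log (gauss y)) := by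
    refine (dom_int (-Real.log (Real.sqrt (2 * Real.pi))) (-1/2) 0).1.congr (ae_of_all _ fun y => ?_)
    simp only [log_gauss, sub_zero]; ring
  have h2 : KK = ∫ y, gauss (y - x) * Real.log (gauss (y - x)) := by
    rw [integral_sub_right_eq_self (fun y => gauss y * Real.log (gauss y)) x, KK]
  rw [h2, ← integral_sub (h1.comp_sub_right x) (inner_int hq h x), relEnt]
  congr 1; ext y
  rw [Real.log_div (gauss_pos _).ne' (outDen_pos hq h y).ne']; ring

lemma relEnt_cont (hq : 0 < q) (h : Good q μ) : Continuous (fun x => relEnt x μ) := by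
  simp_rw [relEnt_eq hq h]
  refine continuous_const.sub ?_
  have e : ∀ x, ∫ y, gauss (y - x) * Real.log (outDen μ y)
      = ∫ y, gauss y * Real.log (outDen μ (y + x)) := by
    intro x
    rw [← integral_add_right_eq_self _ x]
    simp
  simp_rw [e]
  obtain ⟨A, hA, hb⟩ := log_outDen_bound hq h
  rw [continuous_iff_continuousAt]
  intro x₀
  refine continuousAt_of_dominated
    (bound := fun y => gauss (y - 0) * ((A + (|x₀| + 1) ^ 2) + 1 * (y - 0) ^ 2)) ?_ ?_
    (dom_int _ _ 0).1 ?_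
  · refine Eventually.of_forall fun x => ?_
    exact (gauss_cont.mul ((log_outDen_cont hq h).comp
      (continuous_id.add continuous_const))).aestronglyMeasurable
  · filter_upwards [Metric.ball_mem_nhds x₀ one_pos] with x hx
    refine ae_of_all _ fun y => ?_
    have hx1 : |x| ≤ |x₀| + 1 := by
      rw [Metric.mem_ball, Real.dist_eq] at hx
      have := abs_sub_abs_le_abs_sub x x₀
      linarith
    have hx2 : x ^ 2 ≤ (|x₀| + 1) ^ 2 := by
      rw [← sq_abs x]; gcongr
    rw [norm_mul, Real.norm_eq_abs, abs_of_pos (gauss_pos _), Real.norm_eq_abs, sub_zero]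
    refine mul_le_mul_of_nonneg_left ((hb _).trans ?_) (gauss_pos _).le
    nlinarith [sq_nonneg (y - x)]
  · refine ae_of_all _ fun y => ?_
    exact (continuous_const.mul ((log_outDen_cont hq h).comp
      (continuous_const.add continuous_id))).continuousAt

lemma prod_int (hq : 0 < q) (h : Good q μ) (hν : Good q ν) :
    Integrable (fun z : ℝ × ℝ => gauss (z.2 - z.1) * Real.log (outDen ν z.2)) (μ.prod volume) := by
  have := h.prob
  obtain ⟨A, hA, hb⟩ := log_outDen_bound hq hν
  have hd : Integrable (fun z : ℝ × ℝ => gauss (z.2 - z.1) * ((A + z.1 ^ 2) + 1 * (z.2 - z.1) ^ 2))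
      (μ.prod volume) := by
    have hm : AEStronglyMeasurable
        (fun z : ℝ × ℝ => gauss (z.2 - z.1) * ((A + z.1 ^ 2) + 1 * (z.2 - z.1) ^ 2))
        (μ.prod volume) := by
      have := gauss_cont
      exact Continuous.aestronglyMeasurable (by fun_prop)
    rw [integrable_prod_iff hm]
    refine ⟨ae_of_all _ fun x => (dom_int (A + x ^ 2) 1 x).1, ?_⟩
    have e : ∀ x : ℝ, ∫ y, ‖gauss (y - x) * ((A + x ^ 2) + 1 * (y - x) ^ 2)‖
        = (A + x ^ 2) + 1 * ∫ y, gauss y * y ^ 2 := by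
      intro x
      rw [← (dom_int (A + x ^ 2) 1 x).2]
      congr 1; ext y
      rw [Real.norm_of_nonneg]
      have := gauss_pos (y - x)
      positivity
    simp only [e]
    exact ((integrable_const A).add h.sq).add (integrable_const _)
  refine hd.mono' ?_ (ae_of_all _ fun z => bound_aux z.1 z.2 (hb z.2))
  exact ((gauss_cont.comp (continuous_snd.sub continuous_fst)).mul
    ((log_outDen_cont hq hν).comp continuous_snd)).aestronglyMeasurable

lemma out_log_int (hq : 0 < q) (h : Good q μ) (hν : Good q ν) :
    Integrable (fun y => outDen μ y * Real.log (outDen ν y)) := by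
  have := h.prob
  have := (prod_int hq h hν).integral_prod_right
  refine this.congr (ae_of_all _ fun y => ?_)
  simp only [outDen]
  rw [integral_mul_const]

lemma relEnt_int (hq : 0 < q) (h : Good q μ) (hν : Good q ν) :
    Integrable (fun x => relEnt x ν) μ := by
  have := h.prob
  simp_rw [relEnt_eq hq hν]
  exact (integrable_const _).sub (prod_int hq h hν).integral_prod_left

lemma cross_eq (hq : 0 < q) (h : Good q μ) (hν : Good q ν) :
    ∫ x, relEnt x ν ∂μ = KK - ∫ y, outDen μ y * Real.log (outDen ν y) := by
  have := h.prob
  simp_rw [relEnt_eq hq hν]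
  rw [integral_sub (integrable_const _) (prod_int hq h hν).integral_prod_left]
  congr 1
  · simp
  rw [integral_integral_swap (prod_int hq h hν)]
  congr 1; ext y
  simp only [outDen]
  rw [integral_mul_const]

lemma outDen_prod_int (h : Good q μ) :
    Integrable (fun z : ℝ × ℝ => gauss (z.2 - z.1)) (μ.prod volume) := by
  have := h.prob
  have hm : AEStronglyMeasurable (fun z : ℝ × ℝ => gauss (z.2 - z.1)) (μ.prod volume) := by
    have := gauss_cont
    exact Continuous.aestronglyMeasurable (by fun_prop)
  rw [integrable_prod_iff hm]
  refine ⟨ae_of_all _ fun x => gauss_sub_int x, ?_⟩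
  have e : ∀ x : ℝ, ∫ y, ‖gauss (y - x)‖ = 1 := by
    intro x
    rw [← gauss_integral, ← integral_sub_right_eq_self gauss x]
    congr 1; ext y
    rw [Real.norm_of_nonneg (gauss_pos _).le]
  simp only [e]
  exact integrable_const _

lemma outDen_int (h : Good q μ) : Integrable (outDen μ) := by
  have := h.prob
  exact (outDen_prod_int h).integral_prod_right

lemma outDen_integral (h : Good q μ) : ∫ y, outDen μ y = 1 := by
  have := h.prob
  unfold outDen
  rw [← integral_integral_swap (outDen_prod_int h)]
  simp [integral_sub_right_eq_self gauss, gauss_integral]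

lemma gibbs (hq : 0 < q) (h : Good q μ) (hν : Good q ν) :
    mutInfo μ ≤ ∫ x, relEnt x ν ∂μ := by
  rw [mutInfo, cross_eq hq h h, cross_eq hq h hν]
  have : ∫ y, (outDen μ y * Real.log (outDen ν y) - outDen μ y * Real.log (outDen μ y))
      ≤ ∫ y, (outDen ν y - outDen μ y) := by
    refine integral_mono ((out_log_int hq h hν).sub (out_log_int hq h h))
      ((outDen_int hν).sub (outDen_int h)) fun y => ?_
    have p1 := outDen_pos hq h y
    have p2 := outDen_pos hq hν y
    have := Real.log_le_sub_one_of_pos (div_pos p2 p1)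
    rw [Real.log_div p2.ne' p1.ne'] at this
    have := mul_le_mul_of_nonneg_left this p1.le
    have e : outDen μ y * (outDen ν y / outDen μ y - 1) = outDen ν y - outDen μ y := by
      field_simp
    simp only
    linarith
  rw [integral_sub (out_log_int hq h hν) (out_log_int hq h h),
    integral_sub (outDen_int hν) (outDen_int h), outDen_integral h, outDen_integral hν] at this
  linarith

/-- chi-square upper bound -/
lemma chi2 (hq : 0 < q) {μ₀ μ₁ : Measure ℝ} (h0 : Good q μ₀) (h1 : Good q μ₁) (h : Good q μ)
    {θ : ℝ} (hθ : ∀ y, outDen μ y = (1 - θ) * outDen μ₀ y + θ * outDen μ₁ y)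
    (hI : Integrable (fun y => outDen μ₁ y ^ 2 / outDen μ₀ y)) :
    ∫ x, relEnt x μ₀ ∂μ ≤ mutInfo μ + θ ^ 2 * ((∫ y, outDen μ₁ y ^ 2 / outDen μ₀ y) - 1) := by
  rw [mutInfo, cross_eq hq h h, cross_eq hq h h0]
  have i2 : Integrable (fun y => (2 * θ ^ 2 - θ) * outDen μ₀ y) := (outDen_int h0).const_mul _
  have i1 : Integrable (fun y => (θ - 2 * θ ^ 2) * outDen μ₁ y) := (outDen_int h1).const_mul _
  have i3 : Integrable (fun y => θ ^ 2 * (outDen μ₁ y ^ 2 / outDen μ₀ y)) := hI.const_mul _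
  have i4 : Integrable (fun y => (- θ ^ 2) * outDen μ₀ y) := (outDen_int h0).const_mul _
  have : ∫ y, (outDen μ y * Real.log (outDen μ y) - outDen μ y * Real.log (outDen μ₀ y))
      ≤ ∫ y, ((2 * θ ^ 2 - θ) * outDen μ₀ y + (θ - 2 * θ ^ 2) * outDen μ₁ y
        + θ ^ 2 * (outDen μ₁ y ^ 2 / outDen μ₀ y) + (- θ ^ 2) * outDen μ₀ y) := by
    refine integral_mono ((out_log_int hq h h).sub (out_log_int hq h h0))
      (((i2.add i1).add i3).add i4) fun y => ?_
    have p1 := outDen_pos hq h y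
    have p2 := outDen_pos hq h0 y
    have := Real.log_le_sub_one_of_pos (div_pos p1 p2)
    rw [Real.log_div p1.ne' p2.ne'] at this
    have := mul_le_mul_of_nonneg_left this p1.le
    have e : outDen μ y * (outDen μ y / outDen μ₀ y - 1) =
      (2 * θ ^ 2 - θ) * outDen μ₀ y + (θ - 2 * θ ^ 2) * outDen μ₁ y
        + θ ^ 2 * (outDen μ₁ y ^ 2 / outDen μ₀ y) + (- θ ^ 2) * outDen μ₀ y := by
      rw [hθ y]
      field_simp
      ring
    simp only
    linarith
  have j1 := integral_add i2 i1
  have j2 := integral_add (i2.add i1) i3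
  have j3 := integral_add ((i2.add i1).add i3) i4
  simp only [Pi.add_apply] at j1 j2 j3
  rw [integral_sub (out_log_int hq h h) (out_log_int hq h h0),
    j3, j2, j1,
    integral_const_mul, integral_const_mul, integral_const_mul, integral_const_mul,
    outDen_integral h0, outDen_integral h1] at this
  linarith

lemma lagr (h c : ℝ → ℝ) (hmix : ∀ a b t : ℝ, 0 ≤ t → t ≤ 1 → (1 - t) * c a + t * c b ≤ 0 →
    (1 - t) * h a + t * h b ≤ 0) {x₀ : ℝ} (hx₀ : c x₀ < 0) :
    ∃ lam : ℝ, 0 ≤ lam ∧ ∀ x, h x ≤ lam * c x := by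
  set S : Set ℝ := insert 0 {r | ∃ b, 0 < c b ∧ r = h b / c b} with hS
  have h0 : ∀ a, c a ≤ 0 → h a ≤ 0 := by
    intro a ha
    have := hmix a a 0 le_rfl zero_le_one (by simpa using ha)
    simpa using this
  have hub : ∀ a, c a < 0 → ∀ r ∈ S, r ≤ h a / c a := by
    intro a ha r hr
    rcases hr with rfl | ⟨b, hb, rfl⟩
    · exact div_nonneg_of_nonpos (h0 a ha.le) ha.le
    · have hd : 0 < c b - c a := by linarith
      have key := hmix a b (-c a / (c b - c a)) (div_nonneg (by linarith) hd.le)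
        ((div_le_one hd).2 (by linarith)) (le_of_eq (by field_simp; ring))
      have e : (1 - -c a / (c b - c a)) * h a + -c a / (c b - c a) * h b
          = (c b * h a - c a * h b) / (c b - c a) := by field_simp; ring
      rw [e, div_le_iff₀ hd, zero_mul] at key
      rw [div_le_iff₀ hb, div_mul_eq_mul_div, le_div_iff_of_neg ha]
      linarith
  have hbdd : BddAbove S := ⟨_, hub x₀ hx₀⟩
  refine ⟨sSup S, le_csSup hbdd (Set.mem_insert _ _), fun x => ?_⟩
  rcases lt_trichotomy (c x) 0 with hx | hx | hx
  · have := csSup_le (Set.insert_nonempty _ _) (hub x hx)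
    rwa [le_div_iff_of_neg hx] at this
  · rw [hx, mul_zero]; exact h0 x hx.le
  · have : h x / c x ≤ sSup S := le_csSup hbdd (Set.mem_insert_of_mem _ ⟨x, hx, rfl⟩)
    rwa [div_le_iff₀ hx] at this

noncomputable def mix (θ : ℝ) (μ ν : Measure ℝ) : Measure ℝ :=
  ENNReal.ofReal (1 - θ) • μ + ENNReal.ofReal θ • ν

section mix
variable {θ : ℝ} {F : ℝ → ℝ}

lemma mix_integrable (h1 : Integrable F μ) (h2 : Integrable F ν) :
    Integrable F (mix θ μ ν) :=
  (h1.smul_measure ENNReal.ofReal_ne_top).add_measure (h2.smul_measure ENNReal.ofReal_ne_top)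

lemma mix_integral (hθ0 : 0 ≤ θ) (hθ1 : θ ≤ 1) (h1 : Integrable F μ) (h2 : Integrable F ν) :
    ∫ x, F x ∂(mix θ μ ν) = (1 - θ) * ∫ x, F x ∂μ + θ * ∫ x, F x ∂ν := by
  unfold mix
  rw [integral_add_measure (h1.smul_measure ENNReal.ofReal_ne_top)
    (h2.smul_measure ENNReal.ofReal_ne_top), integral_smul_measure, integral_smul_measure,
    ENNReal.toReal_ofReal hθ0, ENNReal.toReal_ofReal (by linarith)]
  rfl

lemma mix_prob (hθ0 : 0 ≤ θ) (hθ1 : θ ≤ 1) [IsProbabilityMeasure μ] [IsProbabilityMeasure ν] :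
    IsProbabilityMeasure (mix θ μ ν) := by
  constructor
  simp only [mix, Measure.add_apply, Measure.smul_apply, measure_univ, smul_eq_mul, mul_one]
  rw [← ENNReal.ofReal_add (by linarith) hθ0]
  simp

lemma mix_real (hθ0 : 0 ≤ θ) (hθ1 : θ ≤ 1) [IsProbabilityMeasure μ] [IsProbabilityMeasure ν]
    (s : Set ℝ) :
    (mix θ μ ν).real s = (1 - θ) * μ.real s + θ * ν.real s := by
  simp only [mix, measureReal_def, Measure.add_apply, Measure.smul_apply, smul_eq_mul]
  rw [ENNReal.toReal_add (ENNReal.mul_ne_top ENNReal.ofReal_ne_top (measure_ne_top _ _))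
    (ENNReal.mul_ne_top ENNReal.ofReal_ne_top (measure_ne_top _ _)), ENNReal.toReal_mul,
    ENNReal.toReal_mul, ENNReal.toReal_ofReal hθ0, ENNReal.toReal_ofReal (by linarith)]

lemma mix_good (hθ0 : 0 ≤ θ) (hθ1 : θ ≤ 1) (h1 : Good q μ) (h2 : Good q ν) :
    Good q (mix θ μ ν) := by
  have := h1.prob
  have := h2.prob
  refine ⟨mix_prob hθ0 hθ1, ?_, mix_integrable h1.sq h2.sq⟩
  rw [mix_real hθ0 hθ1]
  nlinarith [h1.atom, h2.atom]

end mix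

lemma memLam_iff {γ : ℝ} (hγ : 0 < γ) :
    memLam γ q μ ↔ Good q μ ∧ ∫ x, x ^ 2 ∂μ ≤ γ := by
  have hm : AEStronglyMeasurable (fun x : ℝ => x ^ 2) μ :=
    (continuous_pow 2).aestronglyMeasurable
  constructor
  · rintro ⟨hp, ha, hs⟩
    have hi : Integrable (fun x : ℝ => x ^ 2) μ := by
      refine ⟨hm, ?_⟩
      rw [hasFiniteIntegral_iff_ofReal (ae_of_all _ fun x => sq_nonneg x)]
      exact hs.trans_lt ENNReal.ofReal_lt_top
    refine ⟨⟨hp, ?_, hi⟩, ?_⟩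
    · rw [measureReal_def]
      exact (ENNReal.ofReal_le_iff_le_toReal (measure_ne_top _ _)).1 ha
    · rw [← ofReal_integral_eq_lintegral_ofReal hi (ae_of_all _ fun x => sq_nonneg x)] at hs
      exact (ENNReal.ofReal_le_ofReal_iff hγ.le).1 hs
  · rintro ⟨hg, hs⟩
    have := hg.prob
    refine ⟨hg.prob, ?_, ?_⟩
    · exact (ENNReal.ofReal_le_iff_le_toReal (measure_ne_top _ _)).2 hg.atom
    · rw [← ofReal_integral_eq_lintegral_ofReal hg.sq (ae_of_all _ fun x => sq_nonneg x)]
      exact ENNReal.ofReal_le_ofReal hs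

lemma dirac_int (F : ℝ → ℝ) (a : ℝ) : Integrable F (Measure.dirac a) :=
  integrable_dirac (by simp)

lemma gauss_sq_id (y a : ℝ) :
    gauss (y - a) ^ 2 = gauss y * (gauss (y - 2 * a) * Real.exp (a ^ 2)) := by
  unfold gauss
  have : Real.exp (-(y - a) ^ 2 / 2) ^ 2
      = Real.exp (-y ^ 2 / 2) * (Real.exp (-(y - 2 * a) ^ 2 / 2) * Real.exp (a ^ 2)) := by
    rw [← Real.exp_nat_mul, ← Real.exp_add, ← Real.exp_add]
    congr 1; push_cast; ring
  rw [div_pow, this]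
  ring

lemma forward (hq : 0 < q) (hq1 : q < 1) {γ : ℝ} (hγ : 0 < γ) {μ₀ : Measure ℝ}
    (h₀ : memLam γ q μ₀) (hmax : ∀ μ : Measure ℝ, memLam γ q μ → mutInfo μ ≤ mutInfo μ₀)
    (a b t : ℝ) (ht0 : 0 ≤ t) (ht1 : t ≤ 1) (hab : (1 - q) * ((1 - t) * a ^ 2 + t * b ^ 2) ≤ γ) :
    q * relEnt 0 μ₀ + (1 - q) * ((1 - t) * relEnt a μ₀ + t * relEnt b μ₀) ≤ mutInfo μ₀ := by
  obtain ⟨g0, s0⟩ := (memLam_iff hγ).1 h₀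
  have hp0 := g0.prob
  set μ₁ : Measure ℝ := mix (1 - q) (Measure.dirac 0) (mix t (Measure.dirac a) (Measure.dirac b))
    with hμ₁
  have hpm : IsProbabilityMeasure (mix t (Measure.dirac a) (Measure.dirac b)) := mix_prob ht0 ht1
  have hint : ∀ F : ℝ → ℝ, Integrable F μ₁ := fun F =>
    mix_integrable (dirac_int _ _) (mix_integrable (dirac_int _ _) (dirac_int _ _))
  have hval : ∀ F : ℝ → ℝ, ∫ x, F x ∂μ₁ = q * F 0 + (1 - q) * ((1 - t) * F a + t * F b) := by
    intro F
    rw [hμ₁, mix_integral (by linarith) (by linarith) (dirac_int _ _)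
      (mix_integrable (dirac_int _ _) (dirac_int _ _)),
      mix_integral ht0 ht1 (dirac_int _ _) (dirac_int _ _)]
    simp
  have g1 : Good q μ₁ := by
    refine ⟨mix_prob (by linarith) (by linarith), ?_, hint _⟩
    rw [hμ₁, mix_real (by linarith) (by linarith)]
    have : (0 : ℝ) ≤ (mix t (Measure.dirac a) (Measure.dirac b)).real {0} := measureReal_nonneg
    have e : (Measure.dirac (0 : ℝ)).real {0} = 1 := by simp [measureReal_def]
    rw [e]
    nlinarith
  have hp1 := g1.prob
  have hs1 : ∫ x, x ^ 2 ∂μ₁ ≤ γ := by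
    rw [hval]; simpa using hab
  have hI : Integrable (fun y => outDen μ₁ y ^ 2 / outDen μ₀ y) := by
    have hd : Integrable (fun y => 3 / q * (gauss (y - 2 * 0) * Real.exp (0 ^ 2)
        + gauss (y - 2 * a) * Real.exp (a ^ 2) + gauss (y - 2 * b) * Real.exp (b ^ 2))) :=
      ((((gauss_sub_int _).mul_const _).add ((gauss_sub_int _).mul_const _)).add
        ((gauss_sub_int _).mul_const _)).const_mul _
    refine hd.mono' ?_ (ae_of_all _ fun y => ?_)
    · exact (((outDen_cont μ₁).pow 2).div (outDen_cont μ₀)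
        fun y => (outDen_pos hq g0 y).ne').aestronglyMeasurable
    have p0 := outDen_pos hq g0 y
    have p1 := outDen_pos hq g1 y
    rw [Real.norm_of_nonneg (by positivity), div_le_iff₀ p0]
    have hle : outDen μ₁ y ≤ gauss (y - 0) + gauss (y - a) + gauss (y - b) := by
      rw [outDen, hval (fun x => gauss (y - x))]
      have k0 := gauss_pos (y - 0)
      have k1 := gauss_pos (y - a)
      have k2 := gauss_pos (y - b)
      have m1 : (1 - q) * (1 - t) ≤ 1 := by nlinarith
      have m2 : (1 - q) * t ≤ 1 := by nlinarith
      nlinarith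
    have hsq : outDen μ₁ y ^ 2 ≤
        3 * (gauss (y - 0) ^ 2 + gauss (y - a) ^ 2 + gauss (y - b) ^ 2) := by
      have := pow_le_pow_left₀ p1.le hle 2
      nlinarith [sq_nonneg (gauss (y - 0) - gauss (y - a)),
        sq_nonneg (gauss (y - 0) - gauss (y - b)), sq_nonneg (gauss (y - a) - gauss (y - b))]
    rw [gauss_sq_id, gauss_sq_id, gauss_sq_id] at hsq
    set G := gauss (y - 2 * 0) * Real.exp (0 ^ 2)
        + gauss (y - 2 * a) * Real.exp (a ^ 2) + gauss (y - 2 * b) * Real.exp (b ^ 2) with hG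
    have hG0 : 0 ≤ G := by
      have k0 := gauss_pos (y - 2 * 0)
      have k1 := gauss_pos (y - 2 * a)
      have k2 := gauss_pos (y - 2 * b)
      positivity
    calc outDen μ₁ y ^ 2 ≤ 3 * (gauss y * G) := by rw [hG]; linarith
      _ = 3 / q * G * (q * gauss y) := by field_simp
      _ ≤ 3 / q * G * outDen μ₀ y := by
        have := le_outDen g0 y
        gcongr
  set C := (∫ y, outDen μ₁ y ^ 2 / outDen μ₀ y) - 1 with hC
  have key : ∀ θ : ℝ, 0 < θ → θ ≤ 1 → (∫ x, relEnt x μ₀ ∂μ₁) - mutInfo μ₀ ≤ θ * C := by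
    intro θ hθ0 hθ1
    have gθ := mix_good hθ0.le hθ1 g0 g1
    have hc := chi2 (θ := θ) hq g0 g1 gθ (fun y => by
      unfold outDen
      exact mix_integral hθ0.le hθ1 (gauss_mu_int _ _) (gauss_mu_int _ _)) hI
    have hm := hmax _ ((memLam_iff hγ).2 ⟨gθ, by
      rw [mix_integral hθ0.le hθ1 g0.sq g1.sq]
      nlinarith⟩)
    rw [mix_integral hθ0.le hθ1 (relEnt_int hq g0 g0) (hint _), ← hC] at hc
    change (1 - θ) * mutInfo μ₀ + _ ≤ _ at hc
    have : θ * ((∫ x, relEnt x μ₀ ∂μ₁) - mutInfo μ₀) ≤ θ * (θ * C) := by nlinarith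
    exact le_of_mul_le_mul_left this hθ0
  rw [← hval (fun x => relEnt x μ₀)]
  by_contra! hcon
  set δ := (∫ x, relEnt x μ₀ ∂μ₁) - mutInfo μ₀ with hδ
  have hδ0 : 0 < δ := by linarith
  have hCa := abs_nonneg C
  have hden : 0 < δ + |C| + 1 := by linarith
  have hk := key (δ / (δ + |C| + 1)) (by positivity) ((div_le_one hden).2 (by linarith))
  rw [div_mul_eq_mul_div, le_div_iff₀ hden] at hk
  nlinarith [le_abs_self C]

lemma gCost_cont (hq : 0 < q) {γ lam : ℝ} (g : Good q μ) :
    Continuous (fun x => gCost γ q lam x μ) := by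
  have := relEnt_cont hq g
  unfold gCost fCost
  fun_prop

lemma fCost_int (hq : 0 < q) {γ lam : ℝ} (h : Good q μ) (hν : Good q ν) :
    Integrable (fun x => fCost γ lam x ν) μ := by
  have := h.prob
  unfold fCost
  exact ((relEnt_int hq h hν).sub (integrable_const _)).sub
    ((h.sq.sub (integrable_const _)).const_mul _)

lemma fCost_integral (hq : 0 < q) {γ lam : ℝ} (h : Good q μ) (hν : Good q ν) :
    ∫ x, fCost γ lam x ν ∂μ
      = (∫ x, relEnt x ν ∂μ) - mutInfo ν - lam * ((∫ x, x ^ 2 ∂μ) - γ) := by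
  have := h.prob
  unfold fCost
  have i1 : Integrable (fun x => relEnt x ν - mutInfo ν) μ :=
    (relEnt_int hq h hν).sub (integrable_const _)
  have i2 : Integrable (fun x : ℝ => x ^ 2 - γ) μ := h.sq.sub (integrable_const _)
  rw [integral_sub i1 (i2.const_mul _), integral_sub (relEnt_int hq h hν) (integrable_const _),
    integral_const_mul, integral_sub h.sq (integrable_const _)]
  simp

lemma gCost_int (hq : 0 < q) {γ lam : ℝ} (h : Good q μ) (hν : Good q ν) :
    Integrable (fun x => gCost γ q lam x ν) μ := by
  have := h.prob
  unfold gCost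
  exact (integrable_const _).add ((fCost_int hq h hν).const_mul _)

lemma gCost_split (hq : 0 < q) {γ lam : ℝ} (h : Good q μ) (hν : Good q ν) :
    q * fCost γ lam 0 ν + (1 - q) * ∫ x, fCost γ lam x ν ∂μ
      = μ.real {0} * fCost γ lam 0 ν + ∫ x in {0}ᶜ, gCost γ q lam x ν ∂μ := by
  have := h.prob
  have e1 : ∫ x, gCost γ q lam x ν ∂μ
      = q * fCost γ lam 0 ν + (1 - q) * ∫ x, fCost γ lam x ν ∂μ := by
    unfold gCost
    rw [integral_add (integrable_const _) ((fCost_int hq h hν).const_mul _)]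
    simp [integral_const_mul]
  rw [← e1, ← integral_add_compl (measurableSet_singleton (0 : ℝ)) (gCost_int hq h hν),
    integral_singleton, smul_eq_mul]
  congr 2
  unfold gCost; ring

lemma backward (hq : 0 < q) (hq1 : q < 1) {γ lam : ℝ} (hγ : 0 < γ) {μ₀ : Measure ℝ}
    (h₀ : memLam γ q μ₀) (hl : 0 ≤ lam) (hg : ∀ x, gCost γ q lam x μ₀ ≤ 0)
    (h : memLam γ q μ) : mutInfo μ ≤ mutInfo μ₀ := by
  obtain ⟨g0, s0⟩ := (memLam_iff hγ).1 h₀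
  obtain ⟨g, s⟩ := (memLam_iff hγ).1 h
  have h1 := gCost_split hq (γ := γ) (lam := lam) g g0
  have h2 : ∫ x in {0}ᶜ, gCost γ q lam x μ₀ ∂μ ≤ 0 := integral_nonpos fun x => hg x
  have h3 : fCost γ lam 0 μ₀ ≤ 0 := by
    have := hg 0
    unfold gCost at this
    linarith
  have h4 := g.atom
  have h5 : ∫ x, fCost γ lam x μ₀ ∂μ ≤ 0 := by
    have : (1 - q) * ∫ x, fCost γ lam x μ₀ ∂μ ≤ 0 := by nlinarith
    by_contra! hc
    nlinarith
  rw [fCost_integral hq g g0] at h5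
  have := gibbs hq g g0
  nlinarith

lemma slack (hq : 0 < q) (hq1 : q < 1) {γ lam : ℝ} (hγ : 0 < γ) {μ₀ : Measure ℝ}
    (h₀ : memLam γ q μ₀) (hl : 0 ≤ lam) (hg : ∀ x, gCost γ q lam x μ₀ ≤ 0)
    (x : ℝ) (hx : x ∈ ptsIncrease μ₀) (hx0 : x ≠ 0) : gCost γ q lam x μ₀ = 0 := by
  obtain ⟨g0, s0⟩ := (memLam_iff hγ).1 h₀
  have h1 := gCost_split hq (γ := γ) (lam := lam) g0 g0
  have h2 := fCost_integral hq (γ := γ) (lam := lam) g0 g0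
  rw [← mutInfo] at h2
  have h3 : fCost γ lam 0 μ₀ ≤ 0 := by
    have := hg 0
    unfold gCost at this
    linarith
  have h4 := g0.atom
  have h5 : 0 ≤ ∫ x, fCost γ lam x μ₀ ∂μ₀ := by rw [h2]; nlinarith
  have h6 : ∫ x in {0}ᶜ, -gCost γ q lam x μ₀ ∂μ₀ = 0 := by
    rw [integral_neg]
    have : ∫ x in {0}ᶜ, gCost γ q lam x μ₀ ∂μ₀ ≤ 0 := integral_nonpos fun x => hg x
    nlinarith [mul_nonneg (sub_nonneg.2 hq1.le) h5]
  have hint : Integrable (fun x => -gCost γ q lam x μ₀) μ₀ := (gCost_int hq g0 g0).neg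
  rw [setIntegral_eq_zero_iff_of_nonneg_ae (ae_of_all _ fun x => by simpa using hg x)
    hint.integrableOn] at h6
  by_contra hne
  have hlt : gCost γ q lam x μ₀ < 0 := lt_of_le_of_ne (hg x) hne
  have hO : IsOpen ({y | gCost γ q lam y μ₀ < 0} ∩ {0}ᶜ) :=
    (isOpen_lt (gCost_cont hq g0) continuous_const).inter isOpen_compl_singleton
  have hpos := hx _ hO ⟨hlt, hx0⟩
  refine hpos.ne' ?_
  rw [Filter.EventuallyEq, ae_iff, Measure.restrict_apply₀'
    (measurableSet_singleton (0:ℝ)).compl.nullMeasurableSet] at h6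
  refine measure_mono_null ?_ h6
  rintro y ⟨hy, hy0⟩
  refine ⟨?_, hy0⟩
  simp only [Set.mem_setOf_eq] at hy ⊢
  simp only [Pi.zero_apply, neg_eq_zero]
  exact hy.ne

end MIAux

/-- `μ₀ ∈ Λ(γ,q)` maximizes `I` over `Λ(γ,q)` iff there is `λ ≥ 0` with
`g_λ(x;μ₀) ≤ 0` for every `x ∈ ℝ`; furthermore, in that case `g_λ(x;μ₀) = 0` at every nonzero
point of increase of `μ₀`. -/
theorem maximizer_iff_gCost_nonpos (q γ : ℝ) (hq0 : 0 < q) (hq1 : q < 1) (hγ : 0 < γ)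
    (μ₀ : Measure ℝ) (h₀ : memLam γ q μ₀) :
    ((∀ μ : Measure ℝ, memLam γ q μ → mutInfo μ ≤ mutInfo μ₀) ↔
      ∃ lam : ℝ, 0 ≤ lam ∧ ∀ x : ℝ, gCost γ q lam x μ₀ ≤ 0) ∧
    ((∀ μ : Measure ℝ, memLam γ q μ → mutInfo μ ≤ mutInfo μ₀) →
      ∀ lam : ℝ, 0 ≤ lam → (∀ x : ℝ, gCost γ q lam x μ₀ ≤ 0) →
        ∀ x ∈ ptsIncrease μ₀, x ≠ 0 → gCost γ q lam x μ₀ = 0) := by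
  constructor
  · constructor
    · intro hmax
      obtain ⟨lam, hl, hlam⟩ := MIAux.lagr
        (fun x => q * relEnt 0 μ₀ + (1 - q) * relEnt x μ₀ - mutInfo μ₀)
        (fun x => (1 - q) * x ^ 2 - γ) (fun a b t ht0 ht1 hc => by
          have := MIAux.forward hq0 hq1 hγ h₀ hmax a b t ht0 ht1 (by linarith)
          linarith) (x₀ := 0) (by simpa using hγ)
      refine ⟨lam, hl, fun x => ?_⟩
      have := hlam x
      unfold gCost fCost
      linarith
    · rintro ⟨lam, hl, hg⟩ μ hμ
      exact MIAux.backward hq0 hq1 hγ h₀ hl hg hμ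
  · intro _ lam hl hg x hx hx0
    exact MIAux.slack hq0 hq1 hγ h₀ hl hg x hx hx0
end

section
/- Let μ be a Borel probability measure on ℝ with finite second moment, and set a = −∫ x dμ(x) and b = (1/2)(∫ x² dμ(x) + log(2π)). Then for every y ∈ ℝ the output density satisfies e^{−y²/2 − a y − b} ≤ p_Y(y;μ) ≤ 1, and consequently |log p_Y(y;μ)| ≤ y²/2 + a y + b. -/
open MeasureTheory Real

theorem gauss_eq_exp (t : ℝ) :
    gauss t = Real.exp (-t ^ 2 / 2 - Real.log (2 * Real.pi) / 2) := by
  have hpi : (0 : ℝ) < 2 * Real.pi := by positivity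
  rw [gauss, Real.exp_sub, Real.sqrt_eq_rpow, Real.rpow_def_of_pos hpi]
  congr 2
  ring

theorem gauss_le_one (t : ℝ) : gauss t ≤ 1 := by
  rw [gauss_eq_exp, Real.exp_le_one_iff]
  have h : 0 ≤ Real.log (2 * Real.pi) :=
    Real.log_nonneg (by linarith [Real.pi_gt_three])
  nlinarith [sq_nonneg t]

theorem gauss_nonneg (t : ℝ) : 0 ≤ gauss t := by
  rw [gauss_eq_exp]; positivity

theorem gauss_integrable (μ : Measure ℝ) [IsProbabilityMeasure μ] (y : ℝ) :
    Integrable (fun x => gauss (y - x)) μ := by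
  refine Integrable.of_bound (C := 1) ?_ ?_
  · apply Continuous.aestronglyMeasurable
    simp only [gauss_eq_exp]
    fun_prop
  · refine Filter.Eventually.of_forall fun x => ?_
    rw [Real.norm_of_nonneg (gauss_nonneg _)]
    exact gauss_le_one _

/-- for a probability measure `μ` with finite second moment, with
`a = −∫ x dμ` and `b = (1/2)(∫ x² dμ + log(2π))`, the output density satisfies
`e^{−y²/2 − a y − b} ≤ p_Y(y;μ) ≤ 1`, and hence `|log p_Y(y;μ)| ≤ y²/2 + a y + b`. -/
theorem outDen_bounds (μ : Measure ℝ) [IsProbabilityMeasure μ]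
    (h1 : Integrable (fun x : ℝ => x) μ) (h2 : Integrable (fun x : ℝ => x ^ 2) μ)
    (a b : ℝ) (ha : a = -∫ x, x ∂μ) (hb : b = (1 / 2) * ((∫ x, x ^ 2 ∂μ) + Real.log (2 * Real.pi))) :
    ∀ y : ℝ,
      Real.exp (-y ^ 2 / 2 - a * y - b) ≤ outDen μ y ∧
      outDen μ y ≤ 1 ∧
      |Real.log (outDen μ y)| ≤ y ^ 2 / 2 + a * y + b := by
  intro y
  have hI := gauss_integrable μ y
  have hup : outDen μ y ≤ 1 := by
    have h := integral_mono hI (integrable_const (1 : ℝ)) (fun x => gauss_le_one (y - x))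
    simpa [outDen] using h
  have hfun : (fun x : ℝ => -(y - x) ^ 2 / 2 - Real.log (2 * Real.pi) / 2) =
      fun x : ℝ => (y * x - (1 / 2) * x ^ 2) + (-y ^ 2 / 2 - Real.log (2 * Real.pi) / 2) := by
    funext x; ring
  have hlin : Integrable (fun x : ℝ => y * x - (1 / 2) * x ^ 2) μ :=
    (h1.const_mul y).sub (h2.const_mul (1 / 2))
  have hf : Integrable (fun x : ℝ => -(y - x) ^ 2 / 2 - Real.log (2 * Real.pi) / 2) μ := by
    rw [hfun]; exact hlin.add (integrable_const _)
  have hval : ∫ x, (-(y - x) ^ 2 / 2 - Real.log (2 * Real.pi) / 2) ∂μ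
      = -y ^ 2 / 2 - a * y - b := by
    rw [hfun, integral_add hlin (integrable_const _),
      integral_sub (h1.const_mul y) (h2.const_mul (1 / 2)),
      integral_const_mul, integral_const_mul, integral_const, ha, hb]
    simp only [probReal_univ, one_smul]
    ring
  have hlow : Real.exp (-y ^ 2 / 2 - a * y - b) ≤ outDen μ y := by
    simp only [gauss_eq_exp] at hI
    rw [← hval]
    simp only [outDen, gauss_eq_exp]
    exact convexOn_exp.map_integral_le Real.continuous_exp.continuousOn isClosed_univ
      (Filter.Eventually.of_forall fun _ => Set.mem_univ _) hf hI
  refine ⟨hlow, hup, ?_⟩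
  have hpos : 0 < outDen μ y := (Real.exp_pos _).trans_le hlow
  rw [abs_of_nonpos (Real.log_nonpos hpos.le hup)]
  have := (Real.le_log_iff_exp_le hpos).2 hlow
  linarith
end
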